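/- arXiv:2401.05456 — 2 statements merged into one kernel-verified Lean document; each statement's English description precedes it below -/
import Mathlib

section
/- (McCarthy) For complex square matrices A, B, p ≥ 2, and q with 1/p + 1/q = 1: 2·(‖A‖_p^p + ‖B‖_p^p)^(q/p) ≤ ‖A+B‖_p^q + ‖A−B‖_p^q. -/
open scoped ComplexOrder

/-- The Schatten `p`-(quasi)norm of a square complex matrix:
`‖X‖_p = (tr |X|^p)^(1/p)`, computed as `(∑ i, λ_i(Xᴴ * X) ^ (p/2)) ^ (1/p)`,
where `λ_i(Xᴴ * X)` are the (nonnegative) eigenvalues of `Xᴴ * X`, whose square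
roots are the singular values of `X`. -/
noncomputable def schattenNorm {m : Type*} [Fintype m] [DecidableEq m]
    (p : ℝ) (X : Matrix m m ℂ) : ℝ :=
  (∑ i, ((Matrix.posSemidef_conjTranspose_mul_self X).1.eigenvalues i ^ (p / 2))) ^ (1 / p)

open Matrix in
/-- Singular value decomposition of a square matrix, with the singular values given as the square
roots of the eigenvalues of `Xᴴ * X`. -/
theorem exists_svd {m : Type*} [Fintype m] [DecidableEq m] (X : Matrix m m ℂ) :
    ∃ U ∈ unitaryGroup m ℂ, ∃ V ∈ unitaryGroup m ℂ,
      X = U * diagonal (fun i =>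
        ((√((posSemidef_conjTranspose_mul_self X).1.eigenvalues i) : ℝ) : ℂ)) * star V := by
  set hX := (posSemidef_conjTranspose_mul_self X).1
  set l := hX.eigenvalues
  have hl0 : ∀ i, 0 ≤ l i := (posSemidef_conjTranspose_mul_self X).eigenvalues_nonneg
  set V : Matrix m m ℂ := hX.eigenvectorUnitary.1
  have hVmem : V ∈ unitaryGroup m ℂ := hX.eigenvectorUnitary.2
  have hVV : V * star V = 1 := mem_unitaryGroup_iff.1 hVmem
  have hM : (X * V)ᴴ * (X * V) = diagonal (fun i => (l i : ℂ)) := by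
    have := hX.conjStarAlgAut_star_eigenvectorUnitary
    rw [Unitary.conjStarAlgAut_star_apply] at this
    rw [conjTranspose_mul, Matrix.mul_assoc, ← Matrix.mul_assoc Xᴴ, ← Matrix.mul_assoc]
    exact this
  let w : m → EuclideanSpace ℂ m := fun j => WithLp.toLp 2 (fun i => (X * V) i j)
  have hw : ∀ i j, inner ℂ (w i) (w j) = if i = j then (l i : ℂ) else 0 := by
    intro i j
    change _ = diagonal (fun i => (l i : ℂ)) i j
    rw [← hM, mul_apply (M := (X * V)ᴴ)]
    simp only [w, PiLp.inner_apply, conjTranspose_apply, RCLike.inner_apply', RCLike.star_def]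
  let v : m → EuclideanSpace ℂ m := fun j => (((√(l j))⁻¹ : ℝ) : ℂ) • w j
  have hv : Orthonormal ℂ (({j | l j ≠ 0} : Set m).domRestrict v) := by
    rw [orthonormal_iff_ite]
    rintro ⟨i, hi⟩ ⟨j, hj⟩
    change inner ℂ (v i) (v j) = _
    simp only [v, inner_smul_left, inner_smul_right, hw, Subtype.mk.injEq]
    split_ifs with h
    · subst h
      rw [Complex.conj_ofReal]
      norm_cast
      rw [← mul_assoc, ← mul_inv, Real.mul_self_sqrt (hl0 i), inv_mul_cancel₀ hi]
    · simp
  obtain ⟨b, hb⟩ := hv.exists_orthonormalBasis_extension_of_card_eq (by simp)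
  refine ⟨Matrix.of fun i j => b j i, ?_, V, hVmem, ?_⟩
  · rw [mem_unitaryGroup_iff']
    ext i j
    have := orthonormal_iff_ite.1 b.orthonormal i j
    rw [one_apply, ← this]
    simp [PiLp.inner_apply, mul_apply, mul_comm]
  · have : X * V = (Matrix.of fun i j => b j i) * diagonal (fun i => ((√(l i) : ℝ) : ℂ)) := by
      ext i j
      rw [mul_diagonal, Matrix.of_apply]
      change w j i = _
      by_cases h : l j = 0
      · have h0 : w j = 0 := by
          rw [← inner_self_eq_zero (𝕜 := ℂ), hw]; simp [h]
        simp [h0, h]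
      · have hs : ((√(l j) : ℝ) : ℂ) ≠ 0 := by
          exact_mod_cast (Real.sqrt_pos.2 (lt_of_le_of_ne (hl0 j) (Ne.symm h))).ne'
        rw [hb j h]
        simp [v, mul_comm, hs]
    rw [← this, Matrix.mul_assoc, hVV, Matrix.mul_one]

/-- The power `x ^ w` of a nonnegative real, as an entire function of the exponent `w`, with the
convention that every power of `0` vanishes. -/
noncomputable def entirePow (x : ℝ) (w : ℂ) : ℂ :=
  if x = 0 then 0 else Complex.exp (Real.log x * w)

theorem norm_entirePow_le {x : ℝ} (hx : 0 ≤ x) (w : ℂ) : ‖entirePow x w‖ ≤ x ^ w.re := by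
  unfold entirePow
  split_ifs with h
  · simpa using Real.rpow_nonneg hx _
  · rw [Complex.norm_exp, Real.rpow_def_of_pos (lt_of_le_of_ne hx (Ne.symm h))]
    simp

theorem entirePow_ofReal {x : ℝ} (hx : 0 ≤ x) {r : ℝ} (hr : r ≠ 0) :
    entirePow x r = ((x ^ r : ℝ) : ℂ) := by
  unfold entirePow
  split_ifs with h
  · simp [h, Real.zero_rpow hr]
  · rw [Real.rpow_def_of_pos (lt_of_le_of_ne hx (Ne.symm h))]
    push_cast; rfl

/-- Functions that are entire and bounded on the strip `0 ≤ re z ≤ 1`. -/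
def EntireBddOnStrip (f : ℂ → ℂ) : Prop :=
  Differentiable ℂ f ∧ ∃ C, ∀ z ∈ Complex.HadamardThreeLines.verticalClosedStrip 0 1, ‖f z‖ ≤ C

namespace EntireBddOnStrip

theorem const (c : ℂ) : EntireBddOnStrip fun _ => c :=
  ⟨differentiable_const c, ‖c‖, fun _ _ => le_rfl⟩

theorem mul {f g : ℂ → ℂ} (hf : EntireBddOnStrip f) (hg : EntireBddOnStrip g) :
    EntireBddOnStrip fun z => f z * g z := by
  obtain ⟨hf, C, hC⟩ := hf
  obtain ⟨hg, D, hD⟩ := hg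
  refine ⟨hf.mul hg, C * D, fun z hz => ?_⟩
  rw [norm_mul]
  exact mul_le_mul (hC z hz) (hD z hz) (norm_nonneg _) ((norm_nonneg _).trans (hC z hz))

theorem add {f g : ℂ → ℂ} (hf : EntireBddOnStrip f) (hg : EntireBddOnStrip g) :
    EntireBddOnStrip fun z => f z + g z := by
  obtain ⟨hf, C, hC⟩ := hf
  obtain ⟨hg, D, hD⟩ := hg
  exact ⟨hf.add hg, C + D, fun z hz => (norm_add_le _ _).trans (add_le_add (hC z hz) (hD z hz))⟩

theorem sub {f g : ℂ → ℂ} (hf : EntireBddOnStrip f) (hg : EntireBddOnStrip g) :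
    EntireBddOnStrip fun z => f z - g z := by
  simpa [sub_eq_add_neg] using hf.add ((const (-1)).mul hg)

theorem sum {ι : Type*} (s : Finset ι) {f : ι → ℂ → ℂ} (hf : ∀ i, EntireBddOnStrip (f i)) :
    EntireBddOnStrip fun z => ∑ i ∈ s, f i z := by
  classical
  induction s using Finset.induction_on with
  | empty => simpa using const 0
  | insert a s ha ih => simpa [Finset.sum_insert ha] using (hf a).add ih

theorem entirePow_affine (x : ℝ) (c d : ℝ) :
    EntireBddOnStrip fun z => entirePow x (c + d * z) := by
  unfold entirePow
  split_ifs with h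
  · exact const 0
  · refine ⟨by fun_prop, Real.exp (|Real.log x| * (|c| + |d|)), fun z hz => ?_⟩
    obtain ⟨h0, h1⟩ : 0 ≤ z.re ∧ z.re ≤ 1 := hz
    rw [Complex.norm_exp, Real.exp_le_exp]
    have hre : ((Real.log x : ℂ) * (c + d * z)).re = Real.log x * (c + d * z.re) := by simp
    rw [hre]
    refine (le_abs_self _).trans ?_
    rw [abs_mul]
    gcongr
    refine (abs_add_le _ _).trans ?_
    rw [abs_mul, abs_of_nonneg h0]
    nlinarith [abs_nonneg d]

/-- The **Hadamard three-line theorem**, evaluated at a real point. -/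
theorem norm_le_interp {f : ℂ → ℂ} (hf : EntireBddOnStrip f) {a b : ℝ}
    (ha : ∀ z : ℂ, z.re = 0 → ‖f z‖ ≤ a) (hb : ∀ z : ℂ, z.re = 1 → ‖f z‖ ≤ b)
    {t : ℝ} (ht0 : 0 ≤ t) (ht1 : t ≤ 1) : ‖f t‖ ≤ a ^ (1 - t) * b ^ t := by
  obtain ⟨hd, C, hC⟩ := hf
  have := Complex.HadamardThreeLines.norm_le_interp_of_mem_verticalClosedStrip₀₁' f (z := (t : ℂ))
    (a := a) (b := b) ⟨by simpa using ht0, by simpa using ht1⟩ hd.diffContOnCl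
    ⟨C, by rintro _ ⟨z, hz, rfl⟩; exact hC z hz⟩ ha hb
  simpa using this

theorem mul_const_mul {m : Type*} [Fintype m] (M N : Matrix m m ℂ) {X : ℂ → Matrix m m ℂ}
    (hX : ∀ i j, EntireBddOnStrip fun z => X z i j) (i j : m) :
    EntireBddOnStrip fun z => (M * X z * N) i j := by
  simp only [Matrix.mul_apply]
  exact sum _ fun k => (sum _ fun l => (const _).mul (hX _ _)).mul (const _)

end EntireBddOnStrip

open scoped Matrix.Norms.L2Operator in
theorem norm_entry_le_l2_opNorm {m : Type*} [Fintype m] [DecidableEq m] (M : Matrix m m ℂ)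
    (i j : m) : ‖M i j‖ ≤ ‖M‖ := by
  have h := M.l2_opNorm_mulVec (EuclideanSpace.single j 1)
  have h2 := PiLp.norm_apply_le (p := 2)
    ((EuclideanSpace.equiv m ℂ).symm <| M.mulVec (EuclideanSpace.single j (1 : ℂ))) i
  simp at h h2
  exact h2.trans h

/-- The square of the Hilbert-Schmidt norm of a matrix. -/
noncomputable def hsNormSq {m : Type*} [Fintype m] (M : Matrix m m ℂ) : ℝ :=
  ∑ i, ∑ j, ‖M i j‖ ^ 2

theorem hsNormSq_eq_trace {m : Type*} [Fintype m] (M : Matrix m m ℂ) :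
    hsNormSq M = (Matrix.trace (M.conjTranspose * M)).re := by
  simp only [hsNormSq, Matrix.trace, Matrix.diag, Matrix.mul_apply, Complex.re_sum,
    Matrix.conjTranspose_apply]
  rw [Finset.sum_comm]
  refine Finset.sum_congr rfl fun i _ => Finset.sum_congr rfl fun j _ => ?_
  rw [RCLike.star_def, Complex.conj_mul']
  norm_cast

theorem hsNormSq_unitary_mul_mul {m : Type*} [Fintype m] [DecidableEq m] {U V : Matrix m m ℂ}
    (hU : U ∈ Matrix.unitaryGroup m ℂ) (hV : V ∈ Matrix.unitaryGroup m ℂ) (M : Matrix m m ℂ) :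
    hsNormSq (U * M * V) = hsNormSq M := by
  have hU' : U.conjTranspose * U = 1 := Matrix.mem_unitaryGroup_iff'.1 hU
  have hV' : V * V.conjTranspose = 1 := Matrix.mem_unitaryGroup_iff.1 hV
  have : (U * M * V).conjTranspose * (U * M * V)
      = V.conjTranspose * (M.conjTranspose * (U.conjTranspose * U) * M * V) := by
    simp only [Matrix.conjTranspose_mul, Matrix.mul_assoc]
  rw [hsNormSq_eq_trace, hsNormSq_eq_trace, this, Matrix.trace_mul_comm, hU', Matrix.mul_assoc _ V,
    hV', Matrix.mul_one, Matrix.mul_one]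

theorem hsNormSq_diagonal {m : Type*} [Fintype m] [DecidableEq m] (d : m → ℂ) :
    hsNormSq (Matrix.diagonal d) = ∑ i, ‖d i‖ ^ 2 := by
  refine Finset.sum_congr rfl fun i _ => ?_
  rw [Finset.sum_eq_single i] <;> simp +contextual [eq_comm]

theorem hsNormSq_add_add_hsNormSq_sub {m : Type*} [Fintype m] (M N : Matrix m m ℂ) :
    hsNormSq (M + N) + hsNormSq (M - N) = 2 * (hsNormSq M + hsNormSq N) := by
  simp only [hsNormSq, ← Finset.sum_add_distrib, Finset.mul_sum]
  refine Finset.sum_congr rfl fun i _ => Finset.sum_congr rfl fun j _ => ?_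
  have := parallelogram_law_with_norm ℝ (M i j) (N i j)
  simp only [Matrix.add_apply, Matrix.sub_apply, sq]
  linarith

theorem sum_norm_diag_sq_le_hsNormSq {m : Type*} [Fintype m] (M : Matrix m m ℂ) :
    ∑ i, ‖M i i‖ ^ 2 ≤ hsNormSq M :=
  Finset.sum_le_sum fun i _ =>
    Finset.single_le_sum (f := fun j => ‖M i j‖ ^ 2) (fun _ _ => by positivity) (Finset.mem_univ i)

theorem schattenNorm_nonneg {m : Type*} [Fintype m] [DecidableEq m] (p : ℝ) (X : Matrix m m ℂ) :
    0 ≤ schattenNorm p X :=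
  Real.rpow_nonneg (Finset.sum_nonneg fun i _ =>
    Real.rpow_nonneg ((Matrix.posSemidef_conjTranspose_mul_self X).eigenvalues_nonneg i) _) _

theorem exists_svd_schattenNorm {m : Type*} [Fintype m] [DecidableEq m] {p : ℝ} (hp : p ≠ 0)
    (X : Matrix m m ℂ) :
    ∃ U ∈ Matrix.unitaryGroup m ℂ, ∃ V ∈ Matrix.unitaryGroup m ℂ, ∃ s : m → ℝ, (∀ i, 0 ≤ s i) ∧
      X = U * Matrix.diagonal (fun i => (s i : ℂ)) * star V ∧
      schattenNorm p X ^ p = ∑ i, s i ^ p := by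
  obtain ⟨U, hU, V, hV, h⟩ := exists_svd X
  refine ⟨U, hU, V, hV, _, fun i => Real.sqrt_nonneg _, h, ?_⟩
  have hl := (Matrix.posSemidef_conjTranspose_mul_self X).eigenvalues_nonneg
  rw [schattenNorm, ← Real.rpow_mul
    (Finset.sum_nonneg fun i _ => Real.rpow_nonneg (hl i) _), one_div_mul_cancel hp, Real.rpow_one]
  refine Finset.sum_congr rfl fun i _ => ?_
  rw [Real.sqrt_eq_rpow, ← Real.rpow_mul (hl i)]
  ring_nf

/-- An analytic family of singular values through `s`, which interpolates between an `ℓ²` bound on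
`re z = 0` and an `ℓ^∞` bound on `re z = 1` when `a` is the `ℓ^p` norm of `s`. -/
noncomputable def interpDiag {m : Type*} (p q a : ℝ) (s : m → ℝ) (z : ℂ) (i : m) : ℂ :=
  entirePow a (((q - p) / 2 : ℝ) + ((q + p) / 2 : ℝ) * z) *
    entirePow (s i) ((p / 2 : ℝ) + (-(p / 2) : ℝ) * z)

section interpDiag

variable {m : Type*} {p q a : ℝ} {s : m → ℝ}

theorem entireBddOnStrip_interpDiag (p q a : ℝ) (s : m → ℝ) (i : m) :
    EntireBddOnStrip fun z => interpDiag p q a s z i :=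
  (EntireBddOnStrip.entirePow_affine _ _ _).mul (EntireBddOnStrip.entirePow_affine _ _ _)

theorem sum_norm_interpDiag_sq_le [Fintype m] (hp : 0 < p) (hq : 0 < q) (ha : 0 ≤ a)
    (hs : ∀ i, 0 ≤ s i) (has : a ^ p = ∑ i, s i ^ p) {z : ℂ} (hz : z.re = 0) :
    ∑ i, ‖interpDiag p q a s z i‖ ^ 2 ≤ a ^ q := by
  have h : ∀ i, ‖interpDiag p q a s z i‖ ^ 2 ≤ (a ^ ((q - p) / 2)) ^ 2 * s i ^ p := by
    intro i
    have h1 := norm_entirePow_le ha (((q - p) / 2 : ℝ) + ((q + p) / 2 : ℝ) * z)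
    have h2 := norm_entirePow_le (hs i) ((p / 2 : ℝ) + (-(p / 2) : ℝ) * z)
    rw [Complex.add_re, Complex.re_ofReal_mul, Complex.ofReal_re, hz, mul_zero, add_zero] at h1 h2
    have h3 : s i ^ p = (s i ^ (p / 2)) ^ 2 := by
      rw [← Real.rpow_natCast, ← Real.rpow_mul (hs i)]; norm_num
    rw [interpDiag, norm_mul, mul_pow, h3]
    gcongr
  refine (Finset.sum_le_sum fun i _ => h i).trans ?_
  rw [← Finset.mul_sum, ← has]
  rcases ha.eq_or_lt with rfl | ha'
  · simp [Real.zero_rpow hp.ne', Real.zero_rpow hq.ne']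
  · rw [← Real.rpow_natCast, ← Real.rpow_mul ha, ← Real.rpow_add ha']
    norm_num

theorem norm_interpDiag_le (ha : 0 ≤ a) (hs : ∀ i, 0 ≤ s i) {z : ℂ} (hz : z.re = 1) (i : m) :
    ‖interpDiag p q a s z i‖ ≤ a ^ q := by
  have h1 := norm_entirePow_le ha (((q - p) / 2 : ℝ) + ((q + p) / 2 : ℝ) * z)
  have h2 := norm_entirePow_le (hs i) ((p / 2 : ℝ) + (-(p / 2) : ℝ) * z)
  rw [Complex.add_re, Complex.re_ofReal_mul, Complex.ofReal_re, hz] at h1 h2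
  rw [show (q - p) / 2 + (q + p) / 2 * 1 = q by ring] at h1
  rw [show p / 2 + -(p / 2) * 1 = 0 by ring, Real.rpow_zero] at h2
  rw [interpDiag, norm_mul]
  exact (mul_le_mul h1 h2 (norm_nonneg _) (Real.rpow_nonneg ha _)).trans_eq (mul_one _)

theorem interpDiag_apply_of_conj [Fintype m] (hp : 0 < p) (hq : 0 < q) (hpq : 1 / p + 1 / q = 1)
    (hs : ∀ i, 0 ≤ s i) (has : a ^ p = ∑ i, s i ^ p) (i : m) :
    interpDiag p q a s ((1 - 2 / p : ℝ) : ℂ) i = s i := by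
  have h1 : (q - p) / 2 + (q + p) / 2 * (1 - 2 / p) = 0 := by
    field_simp at hpq ⊢
    nlinarith
  have h2 : p / 2 + -(p / 2) * (1 - 2 / p) = 1 := by field_simp; ring
  rw [interpDiag, ← Complex.ofReal_mul, ← Complex.ofReal_mul, ← Complex.ofReal_add,
    ← Complex.ofReal_add, h1, h2, entirePow_ofReal (hs i) one_ne_zero, Real.rpow_one]
  rcases (hs i).eq_or_lt with h | h
  · simp [← h]
  · have ha : a ≠ 0 := by
      rintro rfl
      have := Finset.single_le_sum (f := fun i => s i ^ p) (fun j _ => Real.rpow_nonneg (hs j) _)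
        (Finset.mem_univ i)
      rw [← has, Real.zero_rpow hp.ne'] at this
      exact absurd (Real.rpow_pos_of_pos h p) (not_lt.2 this)
    simp [entirePow, ha]

end interpDiag

open scoped Matrix.Norms.L2Operator in
theorem l2_opNorm_unitary_diagonal_unitary_le {m : Type*} [Fintype m] [DecidableEq m]
    {U V : Matrix m m ℂ} (hU : U ∈ Matrix.unitaryGroup m ℂ) (hV : V ∈ Matrix.unitaryGroup m ℂ)
    {d : m → ℂ} {r : ℝ} (hr : 0 ≤ r) (hd : ∀ i, ‖d i‖ ≤ r) :
    ‖U * Matrix.diagonal d * V‖ ≤ r := by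
  rw [CStarRing.norm_mul_mem_unitary _ hV, CStarRing.norm_mem_unitary_mul _ hU,
    Matrix.l2_opNorm_diagonal]
  exact (pi_norm_le_iff_of_nonneg hr).2 hd

theorem sum_mul_add_sum_mul_le_sqrt {ι : Type*} (s : Finset ι) (f f' g g' : ι → ℝ) :
    ∑ i ∈ s, f i * g i + ∑ i ∈ s, f' i * g' i ≤
      √(∑ i ∈ s, f i ^ 2 + ∑ i ∈ s, f' i ^ 2) * √(∑ i ∈ s, g i ^ 2 + ∑ i ∈ s, g' i ^ 2) := by
  simpa using Real.sum_mul_le_sqrt_mul_sqrt (s.disjSum s) (Sum.elim f f') (Sum.elim g g')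

section pairing

variable {m : Type*} [Fintype m]

/-- The diagonal of `star U * M * V`, paired with the powers of `t` that are dual to
`interpDiag`. -/
noncomputable def dualPairing (p : ℝ) (U V : Matrix m m ℂ) (t : m → ℝ) (z : ℂ)
    (M : Matrix m m ℂ) : ℂ :=
  ∑ i, entirePow (t i) ((p / 2 : ℝ) + (p / 2 : ℝ) * z) * (star U * M * V) i i

variable {p : ℝ} {U V : Matrix m m ℂ} {t : m → ℝ}

theorem EntireBddOnStrip.dualPairing {X : ℂ → Matrix m m ℂ}
    (hX : ∀ i j, EntireBddOnStrip fun z => X z i j) :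
    EntireBddOnStrip fun z => dualPairing p U V t z (X z) :=
  sum _ fun _ => (entirePow_affine _ _ _).mul (mul_const_mul _ _ hX _ _)

theorem norm_dualPairing_le_of_re_eq_zero (ht : ∀ i, 0 ≤ t i) {z : ℂ} (hz : z.re = 0)
    (M : Matrix m m ℂ) :
    ‖dualPairing p U V t z M‖ ≤ ∑ i, t i ^ (p / 2) * ‖(star U * M * V) i i‖ := by
  refine (norm_sum_le _ _).trans (Finset.sum_le_sum fun i _ => ?_)
  have h := norm_entirePow_le (ht i) ((p / 2 : ℝ) + (p / 2 : ℝ) * z)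
  rw [Complex.add_re, Complex.re_ofReal_mul, Complex.ofReal_re, hz, mul_zero, add_zero] at h
  rw [norm_mul]
  gcongr

open scoped Matrix.Norms.L2Operator in
theorem norm_dualPairing_le_of_re_eq_one [DecidableEq m] (hU : U ∈ Matrix.unitaryGroup m ℂ)
    (hV : V ∈ Matrix.unitaryGroup m ℂ) (ht : ∀ i, 0 ≤ t i) {z : ℂ} (hz : z.re = 1)
    (M : Matrix m m ℂ) :
    ‖dualPairing p U V t z M‖ ≤ (∑ i, t i ^ p) * ‖M‖ := by
  rw [Finset.sum_mul]
  refine (norm_sum_le _ _).trans (Finset.sum_le_sum fun i _ => ?_)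
  have h := norm_entirePow_le (ht i) ((p / 2 : ℝ) + (p / 2 : ℝ) * z)
  rw [Complex.add_re, Complex.re_ofReal_mul, Complex.ofReal_re, hz, mul_one, add_halves] at h
  have hM := norm_entry_le_l2_opNorm (star U * M * V) i i
  rw [CStarRing.norm_mul_mem_unitary _ hV,
    CStarRing.norm_mem_unitary_mul _ (Unitary.star_mem hU)] at hM
  rw [norm_mul]
  exact mul_le_mul h hM (norm_nonneg _) (Real.rpow_nonneg (ht i) _)

theorem dualPairing_two_smul [DecidableEq m] (hp : 1 < p) (hU : U ∈ Matrix.unitaryGroup m ℂ)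
    (hV : V ∈ Matrix.unitaryGroup m ℂ) (ht : ∀ i, 0 ≤ t i) {A : Matrix m m ℂ}
    (hA : A = U * Matrix.diagonal (fun i => (t i : ℂ)) * star V) :
    dualPairing p U V t ((1 - 2 / p : ℝ) : ℂ) (A + A) = ((2 * ∑ i, t i ^ p : ℝ) : ℂ) := by
  have hU' : star U * U = 1 := Matrix.mem_unitaryGroup_iff'.1 hU
  have hV' : star V * V = 1 := Matrix.mem_unitaryGroup_iff'.1 hV
  have h : star U * A * V = Matrix.diagonal (fun i => (t i : ℂ)) := by
    rw [hA, Matrix.mul_assoc, Matrix.mul_assoc _ (star V), hV', Matrix.mul_one, ← Matrix.mul_assoc,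
      hU', Matrix.one_mul]
  have he : p / 2 + p / 2 * (1 - 2 / p) = p - 1 := by field_simp; ring
  rw [dualPairing, Matrix.mul_add, Matrix.add_mul, h, Finset.mul_sum, Complex.ofReal_sum]
  refine Finset.sum_congr rfl fun i _ => ?_
  rw [← Complex.ofReal_mul, ← Complex.ofReal_add, he, entirePow_ofReal (ht i) (by linarith),
    Matrix.add_apply, Matrix.diagonal_apply_eq, ← Complex.ofReal_add, ← Complex.ofReal_mul]
  have : t i ^ p = t i ^ (p - 1) * t i := by
    rw [← Real.rpow_add_one' (ht i) (by linarith)]; ring_nf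
  rw [this]
  ring_nf

end pairing

/-- The scalar inequality behind the last step of interpolation arguments for Clarkson-type
inequalities. -/
theorem two_mul_rpow_le_of_interp {p q S T : ℝ} (hp : 0 < p) (hq : 0 < q)
    (hpq : 1 / p + 1 / q = 1) (hS : 0 ≤ S) (hT : 0 ≤ T)
    (h : 2 * T ≤ (√T * √(2 * S)) ^ (2 / p) * (T * S) ^ (1 - 2 / p)) :
    2 * T ^ (q / p) ≤ S := by
  rcases hT.eq_or_lt with rfl | hT
  · simpa [Real.zero_rpow (div_pos hq hp).ne'] using hS
  rcases hS.eq_or_lt with rfl | hS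
  · exfalso
    by_cases h2 : (2 / p) = 0
    · exact (div_pos two_pos hp).ne' h2
    · simp [Real.zero_rpow h2] at h
      linarith
  have key := Real.log_le_log (by positivity) h
  rw [Real.log_mul (by positivity) (by positivity), Real.log_mul (by positivity) (by positivity),
    Real.log_rpow (by positivity), Real.log_rpow (by positivity),
    Real.log_mul (by positivity) (by positivity), Real.log_mul (by positivity) (by positivity),
    Real.log_sqrt hT.le, Real.log_sqrt (by positivity),
    Real.log_mul (by positivity) (by positivity)] at key
  rw [← Real.log_le_log_iff (by positivity) hS, Real.log_mul (by positivity) (by positivity),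
    Real.log_rpow hT]
  have hq' : 1 / p = 1 - 1 / q := by linarith
  have e1 : q * (1 / q) = 1 := by field_simp
  have e2 : q / p = q - 1 := by
    rw [div_eq_mul_one_div, hq']; linear_combination -e1
  have e3 : 2 / p = 2 - 2 * (1 / q) := by rw [div_eq_mul_one_div, hq']; ring
  rw [e2]
  rw [e3] at key
  have := mul_le_mul_of_nonneg_left key hq.le
  linear_combination this + (Real.log T + Real.log S - Real.log 2) * e1

theorem mccarthy_p_ge_two {m : Type*} [Fintype m] [DecidableEq m]
    (A B : Matrix m m ℂ) (p q : ℝ) (hp : 2 ≤ p)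
    (hpq : 1 / p + 1 / q = 1) :
    2 * (schattenNorm p A ^ p + schattenNorm p B ^ p) ^ (q / p) ≤
      schattenNorm p (A + B) ^ q + schattenNorm p (A - B) ^ q := by
  have hp0 : 0 < p := by linarith
  have hq : 0 < q := by
    have : 1 / p ≤ 1 / 2 := one_div_le_one_div_of_le two_pos hp
    exact one_div_pos.1 (by linarith)
  obtain ⟨U₁, hU₁, V₁, hV₁, t₁, ht₁, hA, hnA⟩ := exists_svd_schattenNorm hp0.ne' A
  obtain ⟨U₂, hU₂, V₂, hV₂, t₂, ht₂, hB, hnB⟩ := exists_svd_schattenNorm hp0.ne' B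
  obtain ⟨U₃, hU₃, V₃, hV₃, s₁, hs₁, hX, hnX⟩ := exists_svd_schattenNorm hp0.ne' (A + B)
  obtain ⟨U₄, hU₄, V₄, hV₄, s₂, hs₂, hY, hnY⟩ := exists_svd_schattenNorm hp0.ne' (A - B)
  have ha := schattenNorm_nonneg p (A + B)
  have hb := schattenNorm_nonneg p (A - B)
  set a := schattenNorm p (A + B)
  set b := schattenNorm p (A - B)
  rw [hnA, hnB]
  set T := ∑ i, t₁ i ^ p + ∑ i, t₂ i ^ p with hT
  set S := a ^ q + b ^ q with hS
  have haq : 0 ≤ a ^ q := Real.rpow_nonneg ha q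
  have hbq : 0 ≤ b ^ q := Real.rpow_nonneg hb q
  have hS0 : 0 ≤ S := add_nonneg haq hbq
  have hT0 : 0 ≤ T := add_nonneg (Finset.sum_nonneg fun i _ => Real.rpow_nonneg (ht₁ i) p)
    (Finset.sum_nonneg fun i _ => Real.rpow_nonneg (ht₂ i) p)
  let X : ℂ → Matrix m m ℂ := fun z => U₃ * Matrix.diagonal (interpDiag p q a s₁ z) * star V₃
  let Y : ℂ → Matrix m m ℂ := fun z => U₄ * Matrix.diagonal (interpDiag p q b s₂ z) * star V₄
  have hdiag : ∀ (c : ℝ) (s : m → ℝ) (i j : m), EntireBddOnStrip fun z =>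
      Matrix.diagonal (interpDiag p q c s z) i j := by
    intro c s i j
    simp only [Matrix.diagonal_apply]
    split_ifs
    · exact entireBddOnStrip_interpDiag p q c s i
    · exact EntireBddOnStrip.const 0
  have hXe : ∀ i j, EntireBddOnStrip fun z => X z i j :=
    EntireBddOnStrip.mul_const_mul _ _ (hdiag a s₁)
  have hYe : ∀ i j, EntireBddOnStrip fun z => Y z i j :=
    EntireBddOnStrip.mul_const_mul _ _ (hdiag b s₂)
  have hXθ : X ((1 - 2 / p : ℝ) : ℂ) = A + B := by
    rw [hX]
    simp only [X]
    rw [funext (interpDiag_apply_of_conj hp0 hq hpq hs₁ hnX)]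
  have hYθ : Y ((1 - 2 / p : ℝ) : ℂ) = A - B := by
    rw [hY]
    simp only [Y]
    rw [funext (interpDiag_apply_of_conj hp0 hq hpq hs₂ hnY)]
  let F : ℂ → ℂ := fun z =>
    dualPairing p U₁ V₁ t₁ z (X z + Y z) + dualPairing p U₂ V₂ t₂ z (X z - Y z)
  have hF : EntireBddOnStrip F :=
    (EntireBddOnStrip.dualPairing fun i j => (hXe i j).add (hYe i j)).add
      (EntireBddOnStrip.dualPairing fun i j => (hXe i j).sub (hYe i j))
  have hFθ : F ((1 - 2 / p : ℝ) : ℂ) = ((2 * T : ℝ) : ℂ) := by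
    simp only [F]
    rw [hXθ, hYθ, show A + B + (A - B) = A + A by abel, show A + B - (A - B) = B + B by abel,
      dualPairing_two_smul (by linarith) hU₁ hV₁ ht₁ hA,
      dualPairing_two_smul (by linarith) hU₂ hV₂ ht₂ hB, ← Complex.ofReal_add, hT, mul_add]
  have hF0 : ∀ z : ℂ, z.re = 0 → ‖F z‖ ≤ √T * √(2 * S) := by
    intro z hz
    refine (norm_add_le _ _).trans ((add_le_add (norm_dualPairing_le_of_re_eq_zero ht₁ hz _)
      (norm_dualPairing_le_of_re_eq_zero ht₂ hz _)).trans
        ((sum_mul_add_sum_mul_le_sqrt _ _ _ _ _).trans ?_))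
    have hsq : ∀ {x : ℝ}, 0 ≤ x → (x ^ (p / 2)) ^ 2 = x ^ p := by
      intro x hx
      rw [← Real.rpow_natCast, ← Real.rpow_mul hx]; norm_num
    simp only [hsq (ht₁ _), hsq (ht₂ _)]
    refine mul_le_mul_of_nonneg_left (Real.sqrt_le_sqrt ?_) (Real.sqrt_nonneg _)
    refine (add_le_add (sum_norm_diag_sq_le_hsNormSq _) (sum_norm_diag_sq_le_hsNormSq _)).trans ?_
    rw [hsNormSq_unitary_mul_mul (Unitary.star_mem hU₁) hV₁,
      hsNormSq_unitary_mul_mul (Unitary.star_mem hU₂) hV₂, hsNormSq_add_add_hsNormSq_sub,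
      hsNormSq_unitary_mul_mul hU₃ (Unitary.star_mem hV₃),
      hsNormSq_unitary_mul_mul hU₄ (Unitary.star_mem hV₄), hsNormSq_diagonal, hsNormSq_diagonal]
    exact mul_le_mul_of_nonneg_left (add_le_add
      (sum_norm_interpDiag_sq_le hp0 hq ha hs₁ hnX hz)
      (sum_norm_interpDiag_sq_le hp0 hq hb hs₂ hnY hz)) zero_le_two
  have hF1 : ∀ z : ℂ, z.re = 1 → ‖F z‖ ≤ T * S := by
    open scoped Matrix.Norms.L2Operator in
    intro z hz
    have hXn : ‖X z‖ ≤ a ^ q := l2_opNorm_unitary_diagonal_unitary_le hU₃ (Unitary.star_mem hV₃)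
      haq fun i => norm_interpDiag_le ha hs₁ hz i
    have hYn : ‖Y z‖ ≤ b ^ q := l2_opNorm_unitary_diagonal_unitary_le hU₄ (Unitary.star_mem hV₄)
      hbq fun i => norm_interpDiag_le hb hs₂ hz i
    have hadd : ‖X z + Y z‖ ≤ S := (norm_add_le _ _).trans (add_le_add hXn hYn)
    have hsub : ‖X z - Y z‖ ≤ S := (norm_sub_le _ _).trans (add_le_add hXn hYn)
    refine (norm_add_le _ _).trans ((add_le_add (norm_dualPairing_le_of_re_eq_one hU₁ hV₁ ht₁ hz _)
      (norm_dualPairing_le_of_re_eq_one hU₂ hV₂ ht₂ hz _)).trans ?_)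
    rw [hT, add_mul]
    have h₁ := Finset.sum_nonneg fun i (_ : i ∈ Finset.univ) => Real.rpow_nonneg (ht₁ i) p
    have h₂ := Finset.sum_nonneg fun i (_ : i ∈ Finset.univ) => Real.rpow_nonneg (ht₂ i) p
    exact add_le_add (mul_le_mul_of_nonneg_left hadd h₁) (mul_le_mul_of_nonneg_left hsub h₂)
  have hθ : 2 / p ≤ 1 := (div_le_one hp0).2 hp
  have h := hF.norm_le_interp hF0 hF1 (t := 1 - 2 / p) (by linarith)
    (by have := div_pos two_pos hp0; linarith)
  rw [hFθ, Complex.norm_real, Real.norm_of_nonneg (by positivity), sub_sub_cancel] at h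
  exact two_mul_rpow_le_of_interp hp0 hq hpq hS0 hT0 h
end

section
/- (Conde–Moslehian weak version) Let A_1,…,A_n be complex square matrices, 1 < p ≤ 2, and 1/p + 1/q = 1. Then ‖∑_{i=1}^n A_i‖_p^q + ∑_{1≤i<j≤n} ‖A_i − A_j‖_p^q ≤ n^(q/2)·(∑_{i=1}^n ‖A_i‖_p^p)^(q/p). -/
open scoped ComplexOrder

/-- Splitting a sum over `none` and the pairs `i < j`. -/
lemma sum_option_sigma_Ioi {ι M : Type*} [Fintype ι] [Preorder ι] [LocallyFiniteOrderTop ι]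
    [AddCommMonoid M] (F : Option (Σ i : ι, {j // j ∈ Finset.Ioi i}) → M) (f : ι → ι → M)
    (hF : ∀ i (j : {j // j ∈ Finset.Ioi i}), F (some ⟨i, j⟩) = f i j) :
    ∑ k, F k = F none + ∑ i, ∑ j ∈ Finset.Ioi i, f i j := by
  rw [Fintype.sum_option, Fintype.sum_sigma]
  congr 1
  refine Finset.sum_congr rfl fun i _ => ?_
  rw [← Finset.sum_coe_sort _ (f i)]
  exact Finset.sum_congr rfl fun j _ => hF i j

/-- Superadditivity of `x ↦ x ^ s` on the nonnegative reals, for `1 ≤ s`. -/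
lemma sum_rpow_le_rpow_sum_of_nonneg {ι : Type*} (t : Finset ι) (y : ι → ℝ) (hy : ∀ i, 0 ≤ y i)
    {s : ℝ} (hs : 1 ≤ s) : ∑ i ∈ t, y i ^ s ≤ (∑ i ∈ t, y i) ^ s := by
  classical
  induction t using Finset.induction_on with
  | empty => simp [Real.zero_rpow (show s ≠ 0 by positivity)]
  | insert a t ha ih =>
    rw [Finset.sum_insert ha, Finset.sum_insert ha]
    exact (add_le_add_right ih _).trans
      (Real.add_rpow_le_rpow_add (hy a) (Finset.sum_nonneg fun i _ => hy i) hs)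

/-- Minkowski's inequality in `ℓ_s` for a finite family of nonnegative functions. -/
lemma Lp_sum_le_of_nonneg {ι κ : Type*} [Fintype κ] (t : Finset ι) (u : ι → κ → ℝ)
    (hu : ∀ i k, 0 ≤ u i k) {s : ℝ} (hs : 1 ≤ s) :
    (∑ k, (∑ i ∈ t, u i k) ^ s) ^ (1 / s) ≤ ∑ i ∈ t, (∑ k, u i k ^ s) ^ (1 / s) := by
  classical
  have hs0 : s ≠ 0 := by positivity
  induction t using Finset.induction_on with
  | empty => simp [Real.zero_rpow hs0, Real.zero_rpow (inv_ne_zero hs0)]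
  | insert a t ha ih =>
    simp only [Finset.sum_insert ha]
    exact (Real.Lp_add_le_of_nonneg Finset.univ hs (fun k _ => hu a k)
      (fun k _ => Finset.sum_nonneg fun i _ => hu i k)).trans (by gcongr)

/-- The reverse Minkowski inequality for exponents `0 < r ≤ 1`. -/
lemma sum_Lp_le_of_nonneg {ι κ : Type*} [Fintype ι] [Fintype κ] (x : κ → ι → ℝ)
    (hx : ∀ k i, 0 ≤ x k i) {r : ℝ} (hr0 : 0 < r) (hr1 : r ≤ 1) :
    ∑ k, (∑ i, x k i ^ r) ^ (1 / r) ≤ (∑ i, (∑ k, x k i) ^ r) ^ (1 / r) := by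
  have hnn : 0 ≤ ∑ k, (∑ i, x k i ^ r) ^ (1 / r) :=
    Finset.sum_nonneg fun k _ => Real.rpow_nonneg
      (Finset.sum_nonneg fun i _ => Real.rpow_nonneg (hx k i) _) _
  have key := Lp_sum_le_of_nonneg Finset.univ (fun i k => x k i ^ r)
    (fun i k => Real.rpow_nonneg (hx k i) _) (one_le_one_div hr0 hr1)
  have hpow : ∀ k i, (x k i ^ r) ^ (1 / r) = x k i := fun k i => by
    rw [← Real.rpow_mul (hx k i), mul_one_div_cancel hr0.ne', Real.rpow_one]
  simp only [hpow, one_div_one_div] at key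
  calc _ = ((∑ k, (∑ i, x k i ^ r) ^ (1 / r)) ^ r) ^ (1 / r) := by
        rw [← Real.rpow_mul hnn, mul_one_div_cancel hr0.ne', Real.rpow_one]
    _ ≤ _ := Real.rpow_le_rpow (Real.rpow_nonneg hnn _) key (by positivity)

namespace Matrix

/-- The sum of the `r`-th powers of the eigenvalues (real parts thereof) of a complex matrix;
for a positive semidefinite matrix `H` this is `tr (H ^ r)`. -/
noncomputable def tracePow {m : Type*} [Fintype m] [DecidableEq m] (r : ℝ)
    (H : Matrix m m ℂ) : ℝ :=
  (H.charpoly.roots.map fun z => z.re ^ r).sum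

section

variable {m : Type*} [Fintype m] [DecidableEq m]

lemma IsHermitian.tracePow_eq {H : Matrix m m ℂ} (hH : H.IsHermitian) (r : ℝ) :
    tracePow r H = ∑ i, hH.eigenvalues i ^ r := by
  rw [tracePow, hH.roots_charpoly_eq_eigenvalues, Multiset.map_map]
  rfl

lemma PosSemidef.tracePow_nonneg {H : Matrix m m ℂ} (hH : H.PosSemidef) (r : ℝ) :
    0 ≤ tracePow r H := by
  rw [hH.1.tracePow_eq]
  exact Finset.sum_nonneg fun i _ => Real.rpow_nonneg (hH.eigenvalues_nonneg i) _

lemma tracePow_mul_comm {n : Type*} [Fintype n] [DecidableEq n] {r : ℝ} (hr : r ≠ 0)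
    (A : Matrix m n ℂ) (B : Matrix n m ℂ) : tracePow r (A * B) = tracePow r (B * A) := by
  have h := congrArg (fun P : Polynomial ℂ => (P.roots.map fun z : ℂ => z.re ^ r).sum)
    (charpoly_mul_comm' A B)
  have hX : ∀ (k : ℕ) (P : Polynomial ℂ), P.Monic →
      ((Polynomial.X ^ k * P).roots.map fun z : ℂ => z.re ^ r).sum
        = (P.roots.map fun z : ℂ => z.re ^ r).sum := fun k P hP => by
    rw [Polynomial.roots_mul ((Polynomial.monic_X_pow k).mul hP).ne_zero]
    simp [Multiset.map_nsmul, Multiset.sum_nsmul, Real.zero_rpow hr]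
  simp only [hX _ _ (charpoly_monic _)] at h
  exact h

/-- Conjugating a Hermitian matrix by its eigenvector unitary yields its eigenvalues on the
diagonal. -/
lemma IsHermitian.conj_eigenvectorUnitary_apply {H : Matrix m m ℂ} (hH : H.IsHermitian) (k : m) :
    ((hH.eigenvectorUnitary : Matrix m m ℂ)ᴴ * H * (hH.eigenvectorUnitary : Matrix m m ℂ)) k k
      = hH.eigenvalues k := by
  have h := hH.conjStarAlgAut_star_eigenvectorUnitary
  rw [Unitary.conjStarAlgAut_star_apply, star_eq_conjTranspose] at h
  rw [h]
  simp

/-- Peierls' inequality for the concave function `x ↦ x ^ r`, `0 ≤ r ≤ 1`. -/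
lemma PosSemidef.tracePow_le {H : Matrix m m ℂ} (hH : H.PosSemidef) {U : Matrix m m ℂ}
    (hU : Uᴴ * U = 1) {r : ℝ} (hr0 : 0 ≤ r) (hr1 : r ≤ 1) :
    tracePow r H ≤ ∑ k, ((Uᴴ * H * U) k k).re ^ r := by
  set V := (hH.1.eigenvectorUnitary : Matrix m m ℂ)
  have hVV : V * Vᴴ = 1 := Unitary.coe_mul_star_self hH.1.eigenvectorUnitary
  set W := Vᴴ * U with hW
  have hW1 : Wᴴ * W = 1 := by
    rw [hW, conjTranspose_mul, conjTranspose_conjTranspose, mul_assoc, ← mul_assoc V, hVV,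
      one_mul, hU]
  have hW2 : W * Wᴴ = 1 := mul_eq_one_comm.mp hW1
  have hD : H = V * diagonal (fun i => (hH.1.eigenvalues i : ℂ)) * Vᴴ := by
    have h := hH.1.spectral_theorem
    rwa [Unitary.conjStarAlgAut_apply] at h
  have hcol : ∀ k, ∑ i, Complex.normSq (W i k) = 1 := fun k => by
    have h := congrFun (congrFun hW1 k) k
    simp only [mul_apply, conjTranspose_apply, one_apply_eq, RCLike.star_def,
      ← Complex.normSq_eq_conj_mul_self] at h
    exact_mod_cast h
  have hrow : ∀ i, ∑ k, Complex.normSq (W i k) = 1 := fun i => by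
    have h := congrFun (congrFun hW2 i) i
    simp only [mul_apply, conjTranspose_apply, one_apply_eq, RCLike.star_def,
      Complex.mul_conj] at h
    exact_mod_cast h
  have hdiag : ∀ k, ((Uᴴ * H * U) k k).re
      = ∑ i, Complex.normSq (W i k) * hH.1.eigenvalues i := fun k => by
    have h : Uᴴ * H * U = Wᴴ * diagonal (fun i => (hH.1.eigenvalues i : ℂ)) * W := by
      conv_lhs => rw [hD]
      simp only [hW, conjTranspose_mul, conjTranspose_conjTranspose, mul_assoc]
    rw [h, mul_apply, Complex.re_sum]
    refine Finset.sum_congr rfl fun i _ => ?_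
    rw [mul_diagonal, conjTranspose_apply, mul_right_comm, ← starRingEnd_apply,
      ← Complex.normSq_eq_conj_mul_self, ← Complex.ofReal_mul, Complex.ofReal_re]
  rw [hH.1.tracePow_eq]
  calc ∑ i, hH.1.eigenvalues i ^ r
      = ∑ k, ∑ i, Complex.normSq (W i k) * hH.1.eigenvalues i ^ r := by
        rw [Finset.sum_comm]
        simp only [← Finset.sum_mul, hrow, one_mul]
    _ ≤ _ := by
        refine Finset.sum_le_sum fun k _ => ?_
        rw [hdiag]
        exact (Real.concaveOn_rpow hr0 hr1).le_map_sum (fun i _ => Complex.normSq_nonneg _)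
          (hcol k) (fun i _ => hH.eigenvalues_nonneg i)

/-- Superadditivity of the Schatten quasinorms with exponent `0 < r ≤ 1` on positive semidefinite
matrices. -/
lemma sum_tracePow_rpow_le {κ : Type*} [Fintype κ] {X : κ → Matrix m m ℂ}
    (hX : ∀ k, (X k).PosSemidef) {Z : Matrix m m ℂ} (hZ : Z.PosSemidef) {c : ℝ} (hc : 0 ≤ c)
    (hsum : ∑ k, X k = (c : ℂ) • Z) {r : ℝ} (hr0 : 0 < r) (hr1 : r ≤ 1) :
    ∑ k, tracePow r (X k) ^ (1 / r) ≤ c * tracePow r Z ^ (1 / r) := by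
  set U := (hZ.1.eigenvectorUnitary : Matrix m m ℂ) with hU
  have hUU : Uᴴ * U = 1 := Unitary.coe_star_mul_self hZ.1.eigenvectorUnitary
  have hnn : ∀ k i, 0 ≤ ((Uᴴ * X k * U) i i).re := fun k i =>
    (Complex.le_def.mp ((hX k).conjTranspose_mul_mul_same U).diag_nonneg).1
  have hdiag : ∀ i, ∑ k, ((Uᴴ * X k * U) i i).re = c * hZ.1.eigenvalues i := fun i => by
    have h : ∑ k, Uᴴ * X k * U = (c : ℂ) • (Uᴴ * Z * U) := by
      rw [← Finset.sum_mul, ← Finset.mul_sum, hsum, Matrix.mul_smul, Matrix.smul_mul]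
    have h' := congrArg Complex.re (congrFun (congrFun h i) i)
    rw [smul_apply, hU, hZ.1.conj_eigenvectorUnitary_apply, sum_apply, Complex.re_sum] at h'
    simpa using h'
  calc ∑ k, tracePow r (X k) ^ (1 / r)
      ≤ ∑ k, (∑ i, ((Uᴴ * X k * U) i i).re ^ r) ^ (1 / r) :=
        Finset.sum_le_sum fun k _ => Real.rpow_le_rpow ((hX k).tracePow_nonneg r)
          ((hX k).tracePow_le hUU hr0.le hr1) (by positivity)
    _ ≤ (∑ i, (∑ k, ((Uᴴ * X k * U) i i).re) ^ r) ^ (1 / r) :=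
        sum_Lp_le_of_nonneg _ hnn hr0 hr1
    _ = (c ^ r * tracePow r Z) ^ (1 / r) := by
        simp only [hdiag, hZ.1.tracePow_eq, Finset.mul_sum,
          Real.mul_rpow hc (hZ.eigenvalues_nonneg _)]
    _ = c * tracePow r Z ^ (1 / r) := by
        rw [Real.mul_rpow (Real.rpow_nonneg hc _) (hZ.tracePow_nonneg r), ← Real.rpow_mul hc,
          mul_one_div_cancel hr0.ne', Real.rpow_one]

/-- Rotfel'd's inequality for `x ↦ x ^ r`, `0 < r ≤ 1`. -/
lemma tracePow_sum_conjTranspose_mul_self_le {κ : Type*} [Fintype κ] [DecidableEq κ]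
    (A : κ → Matrix m m ℂ) {r : ℝ} (hr0 : 0 < r) (hr1 : r ≤ 1) :
    tracePow r (∑ i, (A i)ᴴ * A i) ≤ ∑ i, tracePow r ((A i)ᴴ * A i) := by
  let C : Matrix (m × κ) m ℂ := of fun x b => A x.2 x.1 b
  have hC : ∑ i, (A i)ᴴ * A i = Cᴴ * C := by
    ext a b
    simp only [sum_apply, mul_apply, conjTranspose_apply, C, of_apply, Fintype.sum_prod_type]
    exact Finset.sum_comm
  have hP : ∀ i, (A i * (A i)ᴴ).IsHermitian := fun i =>
    (posSemidef_self_mul_conjTranspose (A i)).1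
  let V : κ → Matrix m m ℂ := fun i => (hP i).eigenvectorUnitary
  have hVV : ∀ i, (V i)ᴴ * V i = 1 := fun i => Unitary.coe_star_mul_self (hP i).eigenvectorUnitary
  have hU : (blockDiagonal V)ᴴ * blockDiagonal V = 1 := by
    rw [blockDiagonal_conjTranspose, ← blockDiagonal_mul]
    simp only [hVV]
    exact blockDiagonal_one
  have hblock : ∀ x b, ((blockDiagonal V)ᴴ * C) x b = ((V x.2)ᴴ * A x.2) x.1 b := fun x b => by
    rw [blockDiagonal_conjTranspose]
    simp [mul_apply, Fintype.sum_prod_type, blockDiagonal_apply, C, ite_mul]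
  have hentry : ∀ x, ((blockDiagonal V)ᴴ * (C * Cᴴ) * blockDiagonal V) x x
      = (hP x.2).eigenvalues x.1 := fun x => by
    rw [← (hP x.2).conj_eigenvectorUnitary_apply x.1]
    have h1 : (blockDiagonal V)ᴴ * (C * Cᴴ) * blockDiagonal V
        = ((blockDiagonal V)ᴴ * C) * ((blockDiagonal V)ᴴ * C)ᴴ := by
      simp only [conjTranspose_mul, conjTranspose_conjTranspose, Matrix.mul_assoc]
    have h2 : (V x.2)ᴴ * (A x.2 * (A x.2)ᴴ) * V x.2
        = ((V x.2)ᴴ * A x.2) * ((V x.2)ᴴ * A x.2)ᴴ := by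
      simp only [conjTranspose_mul, conjTranspose_conjTranspose, mul_assoc]
    change _ = ((V x.2)ᴴ * (A x.2 * (A x.2)ᴴ) * V x.2) x.1 x.1
    rw [h1, h2, mul_apply, mul_apply]
    refine Finset.sum_congr rfl fun b _ => ?_
    rw [conjTranspose_apply, conjTranspose_apply, hblock]
  calc tracePow r (∑ i, (A i)ᴴ * A i) = tracePow r (C * Cᴴ) := by
        rw [hC, tracePow_mul_comm hr0.ne']
    _ ≤ ∑ x, (((blockDiagonal V)ᴴ * (C * Cᴴ) * blockDiagonal V) x x).re ^ r :=
        (posSemidef_self_mul_conjTranspose C).tracePow_le hU hr0.le hr1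
    _ = ∑ i, tracePow r ((A i)ᴴ * A i) := by
        simp only [hentry, Complex.ofReal_re, Fintype.sum_prod_type]
        rw [Finset.sum_comm]
        refine Finset.sum_congr rfl fun i _ => ?_
        rw [tracePow_mul_comm hr0.ne', (hP i).tracePow_eq]

/-- The parallelogram identity for `n` matrices. -/
lemma parallelogram_identity {n : ℕ} (A : Fin n → Matrix m m ℂ) :
    (∑ i, A i)ᴴ * (∑ i, A i) + ∑ i, ∑ j ∈ Finset.Ioi i, (A i - A j)ᴴ * (A i - A j)
      = (n : ℂ) • ∑ i, (A i)ᴴ * A i := by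
  have h := Finset.sum_sum_Ioi_add_eq_sum_sum_off_diag
    fun i j => (A i)ᴴ * A i - (A i)ᴴ * A j
  have h1 : ∀ i, ∑ j ∈ ({i}ᶜ : Finset (Fin n)), ((A j)ᴴ * A j - (A j)ᴴ * A i)
      = ∑ j, ((A j)ᴴ * A j - (A j)ᴴ * A i) := fun i => by
    refine Finset.sum_subset (Finset.subset_univ _) fun j _ hj => ?_
    obtain rfl : j = i := by simpa using hj
    exact sub_self _
  have h2 : ∀ i j, (A i - A j)ᴴ * (A i - A j)
      = (A j)ᴴ * A j - (A j)ᴴ * A i + ((A i)ᴴ * A i - (A i)ᴴ * A j) := fun i j => by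
    rw [conjTranspose_sub]
    noncomm_ring
  simp only [h2, h, h1, Finset.sum_sub_distrib, conjTranspose_sum, Finset.sum_mul_sum,
    Finset.sum_const, Finset.card_univ, Fintype.card_fin]
  rw [Finset.sum_comm (f := fun i j => (A j)ᴴ * A i), add_sub_cancel, Nat.cast_smul_eq_nsmul]

lemma schattenNorm_eq (p : ℝ) (X : Matrix m m ℂ) :
    schattenNorm p X = tracePow (p / 2) (Xᴴ * X) ^ (1 / p) := by
  rw [schattenNorm, (posSemidef_conjTranspose_mul_self X).1.tracePow_eq]

lemma schattenNorm_nonneg (p : ℝ) (X : Matrix m m ℂ) : 0 ≤ schattenNorm p X := by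
  rw [schattenNorm_eq]
  exact Real.rpow_nonneg ((posSemidef_conjTranspose_mul_self X).tracePow_nonneg _) _

lemma schattenNorm_rpow (p s : ℝ) (X : Matrix m m ℂ) :
    schattenNorm p X ^ s = tracePow (p / 2) (Xᴴ * X) ^ (s / p) := by
  rw [schattenNorm_eq, ← Real.rpow_mul ((posSemidef_conjTranspose_mul_self X).tracePow_nonneg _),
    one_div_mul_eq_div]

/-- The exponent `2` form of the inequality. -/
lemma sum_schattenNorm_sq_le {n : ℕ} (A : Fin n → Matrix m m ℂ) {p : ℝ} (hp0 : 0 < p)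
    (hp2 : p ≤ 2) :
    schattenNorm p (∑ i, A i) ^ (2 : ℝ) +
        ∑ i, ∑ j ∈ Finset.Ioi i, schattenNorm p (A i - A j) ^ (2 : ℝ) ≤
      n * (∑ i, schattenNorm p (A i) ^ p) ^ (2 / p) := by
  have hr0 : 0 < p / 2 := by positivity
  have hr1 : p / 2 ≤ 1 := by linarith
  let B : Option (Σ i : Fin n, {j // j ∈ Finset.Ioi i}) → Matrix m m ℂ := fun k =>
    k.elim (∑ i, A i) fun x => A x.1 - A x.2
  have hZ : (∑ i, (A i)ᴴ * A i).PosSemidef :=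
    posSemidef_sum _ fun i _ => posSemidef_conjTranspose_mul_self (A i)
  have hsum : ∑ k, (B k)ᴴ * B k = ((n : ℝ) : ℂ) • ∑ i, (A i)ᴴ * A i := by
    rw [sum_option_sigma_Ioi (fun k => (B k)ᴴ * B k)
      (fun i j => (A i - A j)ᴴ * (A i - A j)) fun _ _ => rfl, Complex.ofReal_natCast]
    exact parallelogram_identity A
  have hB := sum_tracePow_rpow_le (fun k => posSemidef_conjTranspose_mul_self (B k)) hZ
    n.cast_nonneg hsum hr0 hr1
  rw [one_div_div] at hB
  simp only [← schattenNorm_rpow] at hB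
  rw [sum_option_sigma_Ioi (fun k => schattenNorm p (B k) ^ (2 : ℝ))
    (fun i j => schattenNorm p (A i - A j) ^ (2 : ℝ)) fun _ _ => rfl] at hB
  refine hB.trans ?_
  have hp : ∀ i, schattenNorm p (A i) ^ p = tracePow (p / 2) ((A i)ᴴ * A i) := fun i => by
    rw [schattenNorm_rpow, div_self hp0.ne', Real.rpow_one]
  simp only [hp]
  exact mul_le_mul_of_nonneg_left (Real.rpow_le_rpow (hZ.tracePow_nonneg _)
    (tracePow_sum_conjTranspose_mul_self_le A hr0 hr1) (by positivity)) n.cast_nonneg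

end

end Matrix

theorem conde_moslehian {m : Type*} [Fintype m] [DecidableEq m] (n : ℕ)
    (A : Fin n → Matrix m m ℂ)
    (p q : ℝ) (hp1 : 1 < p) (hp2 : p ≤ 2) (hpq : 1 / p + 1 / q = 1) :
    schattenNorm p (∑ i, A i) ^ q +
        ∑ i, ∑ j ∈ Finset.Ioi i, schattenNorm p (A i - A j) ^ q ≤
      (n : ℝ) ^ (q / 2) * (∑ i, schattenNorm p (A i) ^ p) ^ (q / p) := by
  have hp0 : 0 < p := by linarith
  have hq : 2 ≤ q := by
    have hp : 1 / 2 ≤ 1 / p := one_div_le_one_div_of_le hp0 hp2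
    have hp' : 1 / p < 1 := (div_lt_one hp0).mpr hp1
    have hq0 : 0 < q := one_div_pos.mp (by linarith)
    exact (one_div_le_one_div hq0 two_pos).mp (by linarith)
  have hs : 1 ≤ q / 2 := by linarith
  have hpow : ∀ X : Matrix m m ℂ,
      schattenNorm p X ^ q = (schattenNorm p X ^ (2 : ℝ)) ^ (q / 2) := fun X => by
    rw [← Real.rpow_mul (Matrix.schattenNorm_nonneg p X), mul_div_cancel₀ _ two_ne_zero]
  have hnn : ∀ X : Matrix m m ℂ, 0 ≤ schattenNorm p X ^ (2 : ℝ) := fun X =>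
    Real.rpow_nonneg (Matrix.schattenNorm_nonneg p X) _
  have hT : 0 ≤ ∑ i, schattenNorm p (A i) ^ p :=
    Finset.sum_nonneg fun i _ => Real.rpow_nonneg (Matrix.schattenNorm_nonneg p _) _
  have hnn' : ∀ i, 0 ≤ ∑ j ∈ Finset.Ioi i, schattenNorm p (A i - A j) ^ (2 : ℝ) := fun i =>
    Finset.sum_nonneg fun j _ => hnn _
  simp only [hpow]
  calc _ ≤ (schattenNorm p (∑ i, A i) ^ (2 : ℝ)) ^ (q / 2) +
        (∑ i, ∑ j ∈ Finset.Ioi i, schattenNorm p (A i - A j) ^ (2 : ℝ)) ^ (q / 2) := by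
        gcongr
        exact (Finset.sum_le_sum fun i _ => sum_rpow_le_rpow_sum_of_nonneg _ _
          (fun j => hnn _) hs).trans (sum_rpow_le_rpow_sum_of_nonneg _ _ hnn' hs)
    _ ≤ (schattenNorm p (∑ i, A i) ^ (2 : ℝ) +
        ∑ i, ∑ j ∈ Finset.Ioi i, schattenNorm p (A i - A j) ^ (2 : ℝ)) ^ (q / 2) :=
        Real.add_rpow_le_rpow_add (hnn _) (Finset.sum_nonneg fun i _ => hnn' i) hs
    _ ≤ (n * (∑ i, schattenNorm p (A i) ^ p) ^ (2 / p)) ^ (q / 2) :=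
        Real.rpow_le_rpow (add_nonneg (hnn _) (Finset.sum_nonneg fun i _ => hnn' i))
          (Matrix.sum_schattenNorm_sq_le A hp0 hp2) (by linarith)
    _ = _ := by
        rw [Real.mul_rpow n.cast_nonneg (Real.rpow_nonneg hT _), ← Real.rpow_mul hT,
          show 2 / p * (q / 2) = q / p by ring]
end
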